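/- Let 0 < α < 1, m > 0, and let U : ℝ → ℝ be twice continuously differentiable. Set L(x,v) = (1/2) m v² − U(x) and H(x,p) = p²/(2m) + U(x). Let (x,p) : [0,∞) → ℝ × ℝ be a bounded C¹ solution with bounded derivatives of the classical canonical equations x′(t) = ∂₂H(x(t),p(t)) = p(t)/m and p′(t) = −∂₁H(x(t),p(t)) = −U′(x(t)). Let p_t(τ) be a measurable family of nonnegative functions satisfying ∫₀^∞ e^{−st} p_t(τ) dt = s^{α−1} e^{−τ s^α} for all s > 0, τ ≥ 0, and define x_α(t) = ∫₀^∞ p_t(τ) x(τ) dτ and p_α(t) = ∫₀^∞ p_t(τ) p(τ) dτ, assumed C¹ on (0,∞) with all relevant functions of t continuous and of at most exponential order. If x_α satisfies the causal fractional Euler–Lagrange equation associated to L, i.e., −U′(x_α(t)) − m · ᶜD^α_{0+}[ s ↦ (ᶜD^α_{0+} x_α)(s) ](t) = 0 for all t > 0, then Stanislavsky's commutation condition holds: ∂₁H(x_α(t),p_α(t)) = ∫₀^∞ p_t(τ) ∂₁H(x(τ),p(τ)) dτ and ∂₂H(x_α(t),p_α(t)) = ∫₀^∞ p_t(τ) ∂₂H(x(τ),p(τ))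 dτ for all t > 0. -/

import Mathlib

open MeasureTheory Set

/-- The left Caputo derivative of order `α` with base point `a`. -/
noncomputable def caputoL (a α : ℝ) (f : ℝ → ℝ) (t : ℝ) : ℝ :=
  (Real.Gamma (1 - α))⁻¹ * ∫ τ in a..t, (t - τ) ^ (-α) * deriv f τ

theorem lap_uniq (h : ℝ → ℝ)
    (hi : ∀ s : ℝ, 0 < s → IntegrableOn (fun t => Real.exp (-s * t) * h t) (Ioi 0))
    (hz : ∀ s : ℝ, 0 < s → ∫ t in Ioi (0:ℝ), Real.exp (-s * t) * h t = 0) :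
    ∀ᵐ t ∂(volume.restrict (Ioi (0:ℝ))), h t = 0 := by
  have h1 := hi 1 one_pos
  have key : ∀ᵐ t ∂(volume : Measure ℝ), t ∈ Ioi (0:ℝ) → Real.exp (-1 * t) * h t = 0 := by
    apply IsOpen.ae_eq_zero_of_integral_contDiff_smul_eq_zero isOpen_Ioi h1.locallyIntegrableOn
    intro g hg hgc hgs
    -- reduce to set integral
    have hsupp : ∀ t, t ∉ Ioi (0:ℝ) → g t = 0 := fun t ht => by
      by_contra hne
      exact ht (hgs (subset_tsupport _ hne))
    have e1 : ∫ t, g t • (Real.exp (-1 * t) * h t)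
        = ∫ t in Ioi (0:ℝ), g t • (Real.exp (-1 * t) * h t) := by
      rw [setIntegral_eq_integral_of_forall_compl_eq_zero]
      intro t ht
      rw [hsupp t ht, zero_smul]
    rw [e1]
    have hpoly : ∀ P : Polynomial ℝ,
        IntegrableOn (fun t => P.eval (Real.exp (-t)) * (Real.exp (-1 * t) * h t)) (Ioi 0) ∧
        ∫ t in Ioi (0:ℝ), P.eval (Real.exp (-t)) * (Real.exp (-1 * t) * h t) = 0 := by
      intro P
      induction P using Polynomial.induction_on' with
      | add p q hp hq =>
        simp only [Polynomial.eval_add, add_mul]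
        exact ⟨hp.1.add hq.1, by rw [integral_add hp.1 hq.1, hp.2, hq.2, add_zero]⟩
      | monomial n a =>
        have : (fun t => (Polynomial.monomial n a).eval (Real.exp (-t)) * (Real.exp (-1 * t) * h t))
          = fun t => a * (Real.exp (-((n:ℝ) + 1) * t) * h t) := by
          funext t
          rw [Polynomial.eval_monomial, ← Real.exp_nat_mul,
            show -((n:ℝ) + 1) * t = n * (-t) + -1 * t by ring, Real.exp_add]
          ring
        simp only [this]
        have hn : (0:ℝ) < n + 1 := by positivity
        refine ⟨(hi _ hn).const_mul a, ?_⟩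
        rw [integral_const_mul, hz _ hn, mul_zero]
    -- the transported test function
    have hψ : ContinuousOn (fun u => g (-Real.log u)) (Icc 0 1) := by
      intro u hu
      rcases hu.1.eq_or_lt with h0 | h0
      · subst h0
        obtain ⟨R, hR⟩ := hgc.isCompact.isBounded.subset_closedBall 0
        have hzero : ∀ t, R < t → g t = 0 := fun t ht => by
          by_contra hne
          have := hR (subset_tsupport _ hne)
          simp only [Metric.mem_closedBall, dist_zero_right, Real.norm_eq_abs] at this
          linarith [le_abs_self t]
        apply ContinuousWithinAt.congr_of_eventuallyEq (f := fun _ => (0:ℝ))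
        · exact continuousWithinAt_const
        · have : Iio (Real.exp (-R)) ∈ nhdsWithin (0:ℝ) (Icc 0 1) :=
            mem_nhdsWithin_of_mem_nhds (Iio_mem_nhds (Real.exp_pos _))
          filter_upwards [this, self_mem_nhdsWithin] with v hv hv2
          rcases hv2.1.eq_or_lt with h0 | h0
          · subst h0; simpa using hsupp 0 (by simp)
          · apply hzero
            have := (Real.log_lt_iff_lt_exp h0).2 hv
            linarith
        · simpa using hsupp 0 (by simp)
      · exact (hg.continuous.continuousAt.comp
          (Real.continuousAt_log h0.ne').neg).continuousWithinAt
    have hbound : ∀ ε > 0, |∫ t in Ioi (0:ℝ), g t • (Real.exp (-1 * t) * h t)|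
        ≤ ε * ∫ t in Ioi (0:ℝ), |Real.exp (-1 * t) * h t| := by
      intro ε hε
      obtain ⟨P, hP⟩ := exists_polynomial_near_of_continuousOn 0 1 _ hψ ε hε
      have hgi : IntegrableOn (fun t => g t • (Real.exp (-1 * t) * h t)) (Ioi 0) := by
        obtain ⟨C, hC⟩ := hg.continuous.bounded_above_of_compact_support hgc
        exact h1.bdd_mul (c := C) hg.continuous.aestronglyMeasurable (.of_forall hC)
      have : ∫ t in Ioi (0:ℝ), g t • (Real.exp (-1 * t) * h t)
          = ∫ t in Ioi (0:ℝ), (g t - P.eval (Real.exp (-t))) * (Real.exp (-1 * t) * h t) := by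
        simp only [smul_eq_mul] at hgi
        simp only [sub_mul, smul_eq_mul]
        rw [integral_sub hgi (hpoly P).1, (hpoly P).2, sub_zero]
      rw [this, ← integral_const_mul, ← Real.norm_eq_abs]
      apply norm_integral_le_of_norm_le (h1.norm.const_mul ε)
      refine (ae_restrict_iff' measurableSet_Ioi).2 (.of_forall fun t ht => ?_)
      rw [norm_mul]
      gcongr
      have := hP (Real.exp (-t)) ⟨(Real.exp_pos _).le, Real.exp_le_one_iff.2 (by simpa using ht.le)⟩
      rw [Real.log_exp, neg_neg] at this
      rw [Real.norm_eq_abs, abs_sub_comm]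
      exact this.le
    have hI : 0 ≤ ∫ t in Ioi (0:ℝ), |Real.exp (-1 * t) * h t| := integral_nonneg fun _ => abs_nonneg _
    set I := ∫ t in Ioi (0:ℝ), |Real.exp (-1 * t) * h t|
    rw [← abs_nonpos_iff]
    apply le_of_forall_pos_le_add
    intro ε hε
    refine (hbound (ε / (I + 1)) (by positivity)).trans ?_
    rw [zero_add, div_mul_eq_mul_div, div_le_iff₀ (by positivity)]
    nlinarith
  rw [ae_restrict_iff' measurableSet_Ioi]
  filter_upwards [key] with t ht h0
  simpa [Real.exp_ne_zero] using ht h0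

/-- Averaging against the density `pd t`. -/
noncomputable def avgOp (pd : ℝ → ℝ → ℝ) (f : ℝ → ℝ) (t : ℝ) : ℝ :=
  ∫ τ in Ioi (0 : ℝ), pd t τ * f τ

theorem lap_avg (α : ℝ) (pd : ℝ → ℝ → ℝ)
    (hmeas : Measurable (Function.uncurry pd))
    (hnonneg : ∀ t τ : ℝ, 0 < t → 0 ≤ τ → 0 ≤ pd t τ)
    (hlap : ∀ s τ : ℝ, 0 < s → 0 ≤ τ →
      IntegrableOn (fun t : ℝ => Real.exp (-s * t) * pd t τ) (Ioi 0) ∧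
      ∫ t in Ioi (0 : ℝ), Real.exp (-s * t) * pd t τ = s ^ (α - 1) * Real.exp (-τ * s ^ α))
    (f : ℝ → ℝ) (hf : Measurable f)
    (hfi : ∀ c : ℝ, 0 < c → IntegrableOn (fun τ => Real.exp (-c * τ) * f τ) (Ioi 0))
    (s : ℝ) (hs : 0 < s) :
    IntegrableOn (fun t => Real.exp (-s * t) * avgOp pd f t) (Ioi 0) ∧
    ∫ t in Ioi (0:ℝ), Real.exp (-s * t) * avgOp pd f t
      = s ^ (α - 1) * ∫ τ in Ioi (0:ℝ), Real.exp (-(s ^ α) * τ) * f τ ∧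
    ∀ᵐ t ∂(volume.restrict (Ioi (0:ℝ))), IntegrableOn (fun τ => pd t τ * f τ) (Ioi 0) := by
  have hI : Integrable (fun z : ℝ × ℝ => Real.exp (-s * z.1) * (pd z.1 z.2 * f z.2))
      ((volume.restrict (Ioi (0:ℝ))).prod (volume.restrict (Ioi (0:ℝ)))) := by
    have hm : Measurable (fun z : ℝ × ℝ => Real.exp (-s * z.1) * (pd z.1 z.2 * f z.2)) := by
      have : Measurable (fun z : ℝ × ℝ => pd z.1 z.2) := hmeas
      fun_prop
    rw [integrable_prod_iff' hm.aestronglyMeasurable]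
    constructor
    · refine (ae_restrict_iff' measurableSet_Ioi).2 (.of_forall fun τ hτ => ?_)
      have := (hlap s τ hs (le_of_lt hτ)).1.mul_const (f τ)
      simpa only [mul_assoc] using this
    · have := ((hfi (s ^ α) (by positivity)).norm).const_mul (s ^ (α - 1))
      refine Integrable.congr this ?_
      refine (ae_restrict_iff' measurableSet_Ioi).2 (.of_forall fun τ hτ => ?_)
      have e : ∫ t in Ioi (0:ℝ), ‖Real.exp (-s * t) * (pd t τ * f τ)‖
          = ∫ t in Ioi (0:ℝ), (Real.exp (-s * t) * pd t τ) * |f τ| := by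
        apply setIntegral_congr_fun measurableSet_Ioi
        intro t ht
        simp only [norm_mul, Real.norm_eq_abs, Real.abs_exp,
          abs_of_nonneg (hnonneg t τ ht (le_of_lt hτ)), mul_assoc]
      simp only
      rw [e, integral_mul_const, (hlap s τ hs (le_of_lt hτ)).2]
      simp only [norm_mul, Real.norm_eq_abs, Real.abs_exp]
      rw [show -τ * s ^ α = -(s ^ α) * τ by ring]
      ring
  refine ⟨?_, ?_, ?_⟩
  · have := hI.integral_prod_left
    simp only [integral_const_mul] at this
    exact this
  · have := integral_integral_swap (f := fun t τ => Real.exp (-s * t) * (pd t τ * f τ)) hI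
    simp only [integral_const_mul] at this
    unfold avgOp
    rw [this, ← integral_const_mul]
    apply setIntegral_congr_fun measurableSet_Ioi
    intro τ hτ
    simp only [← mul_assoc]
    rw [integral_mul_const, (hlap s τ hs (le_of_lt hτ)).2]
    rw [show -τ * s ^ α = -(s ^ α) * τ by ring]
  · filter_upwards [hI.prod_right_ae] with t ht
    have := ht.const_mul (Real.exp (s * t))
    simp only [← mul_assoc, ← Real.exp_add] at this
    simpa [IntegrableOn] using this

theorem exp_bdd_integrable (f : ℝ → ℝ) (hf : Measurable f) (M : ℝ)
    (hM : ∀ t, 0 ≤ t → |f t| ≤ M) (c : ℝ) (hc : 0 < c) :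
    IntegrableOn (fun τ => Real.exp (-c * τ) * f τ) (Ioi 0) := by
  have h1 : IntegrableOn (fun τ => Real.exp (-c * τ)) (Ioi 0) := exp_neg_integrableOn_Ioi 0 hc
  refine Integrable.mono' (h1.mul_const M) (by fun_prop) ?_
  refine (ae_restrict_iff' measurableSet_Ioi).2 (.of_forall fun τ hτ => ?_)
  rw [norm_mul, Real.norm_eq_abs, Real.abs_exp]
  gcongr
  exact hM τ (le_of_lt hτ)

theorem rat_dense_nonneg (g : ℝ → ℝ) (hg : ContinuousOn g (Ioi 0))
    (h : ∀ q : ℚ, (0:ℝ) < q → 0 ≤ g q) (t : ℝ) (ht : 0 < t) : 0 ≤ g t := by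
  by_contra hneg
  push Not at hneg
  have hopen : IsOpen (Ioi (0:ℝ) ∩ g ⁻¹' (Iio 0)) := hg.isOpen_inter_preimage isOpen_Ioi isOpen_Iio
  obtain ⟨q, hq⟩ := Rat.denseRange_cast.exists_mem_open hopen ⟨t, ht, hneg⟩
  exact absurd (h q hq.1) (not_le.2 hq.2)

theorem avg_scale (α : ℝ) (pd : ℝ → ℝ → ℝ)
    (hmeas : Measurable (Function.uncurry pd))
    (hnonneg : ∀ t τ : ℝ, 0 < t → 0 ≤ τ → 0 ≤ pd t τ)
    (hlap : ∀ s τ : ℝ, 0 < s → 0 ≤ τ →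
      IntegrableOn (fun t : ℝ => Real.exp (-s * t) * pd t τ) (Ioi 0) ∧
      ∫ t in Ioi (0 : ℝ), Real.exp (-s * t) * pd t τ = s ^ (α - 1) * Real.exp (-τ * s ^ α))
    (f : ℝ → ℝ) (hf : Measurable f) (M : ℝ) (hM : ∀ t, 0 ≤ t → |f t| ≤ M)
    (l : ℝ) (hl : 0 < l) :
    ∀ᵐ t ∂(volume.restrict (Ioi (0:ℝ))),
      avgOp pd f (l * t) - avgOp pd (fun τ => f (l ^ α * τ)) t = 0 := by
  have hla : 0 < l ^ α := by positivity
  have hA := lap_avg α pd hmeas hnonneg hlap f hf (exp_bdd_integrable f hf M hM)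
  have hf2 : Measurable (fun τ => f (l ^ α * τ)) := by fun_prop
  have hB := lap_avg α pd hmeas hnonneg hlap (fun τ => f (l ^ α * τ)) hf2
    (exp_bdd_integrable _ hf2 M fun t ht => hM _ (by positivity))
  have hAi : ∀ s : ℝ, 0 < s →
      IntegrableOn (fun t => Real.exp (-s * t) * avgOp pd f (l * t)) (Ioi 0) := by
    intro s hs
    have := (hA (s / l) (by positivity)).1
    have h2 := (integrableOn_Ioi_comp_mul_left_iff
      (fun t => Real.exp (-(s / l) * t) * avgOp pd f t) 0 hl).2 (by simpa using this)
    refine h2.congr_fun (fun t _ => ?_) measurableSet_Ioi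
    simp only
    rw [show -(s / l) * (l * t) = -s * t by field_simp]
  apply lap_uniq
  · intro s hs
    simp only [mul_sub]
    exact (hAi s hs).sub (hB s hs).1
  · intro s hs
    simp only [mul_sub]
    rw [integral_sub (hAi s hs) (hB s hs).1, (hB s hs).2.1, sub_eq_zero]
    have e1 := integral_comp_mul_left_Ioi
      (fun t => Real.exp (-(s / l) * t) * avgOp pd f t) 0 hl
    have e2 := integral_comp_mul_left_Ioi
      (fun t => Real.exp (-((s / l) ^ α) * t) * f t) 0 hla
    simp only [mul_zero, smul_eq_mul] at e1 e2
    have e3 : ∀ t, -(s / l) * (l * t) = -s * t := fun t => by field_simp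
    have e4 : ∀ t, -((s / l) ^ α) * (l ^ α * t) = -(s ^ α) * t := fun t => by
      rw [Real.div_rpow hs.le hl.le]; field_simp
    simp only [e3, e4] at e1 e2
    rw [e1, e2, (hA (s / l) (by positivity)).2.1, Real.div_rpow hs.le hl.le,
      Real.rpow_sub hl, Real.rpow_one]
    field_simp

theorem avg_lip (α : ℝ) (hα0 : 0 < α) (pd : ℝ → ℝ → ℝ)
    (hmeas : Measurable (Function.uncurry pd))
    (hnonneg : ∀ t τ : ℝ, 0 < t → 0 ≤ τ → 0 ≤ pd t τ)
    (hlap : ∀ s τ : ℝ, 0 < s → 0 ≤ τ →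
      IntegrableOn (fun t : ℝ => Real.exp (-s * t) * pd t τ) (Ioi 0) ∧
      ∫ t in Ioi (0 : ℝ), Real.exp (-s * t) * pd t τ = s ^ (α - 1) * Real.exp (-τ * s ^ α))
    (f : ℝ → ℝ) (hf : Measurable f) (M : ℝ) (hM : ∀ t, 0 ≤ t → |f t| ≤ M)
    (hL : ∀ t u, 0 ≤ t → 0 ≤ u → |f t - f u| ≤ M * |t - u|)
    (fα : ℝ → ℝ) (hfα : ∀ t, 0 < t → fα t = avgOp pd f t) (hc : ContinuousOn fα (Ioi 0)) :
    ∃ C : ℝ, 0 ≤ C ∧ (∀ t u, 0 < t → 0 < u → |fα t - fα u| ≤ C * |t ^ α - u ^ α|) ∧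
      ∀ t, 0 < t → |fα t - f 0| ≤ C * t ^ α := by
  have hM0 : 0 ≤ M := (abs_nonneg _).trans (hM 0 le_rfl)
  have hA1 := lap_avg α pd hmeas hnonneg hlap (fun _ => 1) measurable_const
    (exp_bdd_integrable _ measurable_const 1 (fun _ _ => by simp))
  have hid : ∀ c : ℝ, 0 < c → IntegrableOn (fun τ : ℝ => Real.exp (-c * τ) * τ) (Ioi 0) := by
    intro c hc
    have := integrableOn_rpow_mul_exp_neg_mul_rpow (p := 1) (s := 1) (b := c)
      (by norm_num) one_pos hc
    simpa only [Real.rpow_one, mul_comm] using this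
  have hAid := lap_avg α pd hmeas hnonneg hlap (fun τ => τ) measurable_id hid
  have hone : ∀ᵐ t ∂(volume.restrict (Ioi (0:ℝ))), avgOp pd (fun _ => 1) t - 1 = 0 := by
    have hi1 : ∀ s : ℝ, 0 < s → IntegrableOn (fun t => Real.exp (-s * t) * (1:ℝ)) (Ioi 0) :=
      exp_bdd_integrable _ measurable_const 1 (fun _ _ => by simp)
    apply lap_uniq
    · intro s hs
      simp only [mul_sub]
      exact (hA1 s hs).1.sub (hi1 s hs)
    · intro s hs
      simp only [mul_sub]
      rw [integral_sub (hA1 s hs).1 (hi1 s hs), (hA1 s hs).2.1]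
      have hsa : 0 < s ^ α := by positivity
      simp only [mul_one]
      rw [integral_exp_mul_Ioi (by linarith), integral_exp_mul_Ioi (by linarith)]
      rw [Real.rpow_sub hs, Real.rpow_one]
      simp
      field_simp
      simp
  have hscale : ∀ᵐ t ∂(volume.restrict (Ioi (0:ℝ))), ∀ q : ℚ, (0:ℝ) < q →
      avgOp pd f (q * t) - avgOp pd (fun τ => f ((q:ℝ) ^ α * τ)) t = 0 := by
    rw [ae_all_iff]
    intro q
    by_cases hq : (0:ℝ) < q
    · filter_upwards [avg_scale α pd hmeas hnonneg hlap f hf M hM q hq] with t ht _ using ht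
    · exact .of_forall fun t h => absurd h hq
  have hpos : ∀ᵐ t ∂(volume.restrict (Ioi (0:ℝ))), 0 < t :=
    (ae_restrict_iff' measurableSet_Ioi).2 (.of_forall fun t ht => ht)
  have hnb : (ae (volume.restrict (Ioi (0:ℝ)))).NeBot := by
    rw [ae_neBot]
    intro h
    have := congrArg (fun μ => μ univ) h
    simp at this
  obtain ⟨t₀, ht₀, h1, hsc, hi1, hii⟩ :=
    (hpos.and (hone.and (hscale.and ((hA1 1 one_pos).2.2.and (hAid 1 one_pos).2.2)))).exists
  simp only [mul_one] at hi1
  have h1' : ∫ τ in Ioi (0:ℝ), pd t₀ τ = 1 := by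
    have : avgOp pd (fun _ => 1) t₀ = 1 := by linarith
    simpa [avgOp] using this
  set m1 : ℝ := ∫ τ in Ioi (0:ℝ), pd t₀ τ * τ with hm1
  have hm1n : 0 ≤ m1 := setIntegral_nonneg measurableSet_Ioi fun τ hτ =>
    mul_nonneg (hnonneg _ _ ht₀ (le_of_lt hτ)) (le_of_lt hτ)
  have hfi : ∀ r : ℝ, 0 ≤ r → IntegrableOn (fun τ => pd t₀ τ * f (r * τ)) (Ioi 0) := by
    intro r hr
    refine Integrable.mul_bdd (c := M) hi1
      (hf.comp (measurable_const_mul r)).aestronglyMeasurable ?_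
    refine (ae_restrict_iff' measurableSet_Ioi).2 (.of_forall fun τ hτ => ?_)
    exact hM _ (mul_nonneg hr (le_of_lt hτ))
  have hdiff : ∀ r r' : ℝ, 0 ≤ r → 0 ≤ r' →
      |avgOp pd (fun τ => f (r * τ)) t₀ - avgOp pd (fun τ => f (r' * τ)) t₀|
        ≤ M * m1 * |r - r'| := by
    intro r r' hr hr'
    unfold avgOp
    rw [← integral_sub (hfi r hr) (hfi r' hr'), ← Real.norm_eq_abs]
    have := norm_integral_le_of_norm_le (f := fun τ => pd t₀ τ * f (r * τ) - pd t₀ τ * f (r' * τ))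
      (μ := volume.restrict (Ioi (0:ℝ))) (hii.mul_const (M * |r - r'|)) ?_
    · refine this.trans (le_of_eq ?_)
      rw [integral_mul_const]; ring
    · refine (ae_restrict_iff' measurableSet_Ioi).2 (.of_forall fun τ hτ => ?_)
      have hτ0 : 0 ≤ τ := le_of_lt hτ
      have hp := hnonneg _ _ ht₀ hτ0
      rw [← mul_sub, norm_mul, Real.norm_eq_abs, Real.norm_eq_abs, abs_of_nonneg hp, mul_assoc]
      gcongr
      refine (hL _ _ (by positivity) (by positivity)).trans (le_of_eq ?_)
      rw [← sub_mul, abs_mul, abs_of_nonneg hτ0]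
      ring
  have hzero : avgOp pd (fun τ => f (0 * τ)) t₀ = f 0 := by
    simp only [avgOp, zero_mul]
    rw [integral_mul_const, h1', one_mul]
  have hq : ∀ q : ℚ, (0:ℝ) < q → fα (q * t₀) = avgOp pd (fun τ => f ((q:ℝ) ^ α * τ)) t₀ := by
    intro q hq
    rw [hfα _ (by positivity)]
    linarith [hsc q hq]
  have hcs : ContinuousOn (fun l : ℝ => fα (l * t₀)) (Ioi 0) :=
    hc.comp (by fun_prop) fun l hl => mul_pos hl ht₀
  have hcp : ContinuousOn (fun l : ℝ => l ^ α) (Ioi 0) :=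
    continuousOn_id.rpow_const fun l _ => Or.inr hα0.le
  have s1 : ∀ (q : ℚ), (0:ℝ) < q → ∀ l : ℝ, 0 < l →
      0 ≤ M * m1 * |l ^ α - (q:ℝ) ^ α| - |fα (l * t₀) - fα (q * t₀)| := by
    intro q hq0
    apply rat_dense_nonneg
    · exact (((hcp.sub continuousOn_const).abs).const_mul _).sub
        ((hcs.sub continuousOn_const).abs)
    · intro q' hq'
      rw [hq q hq0, hq q' hq', sub_nonneg]
      exact hdiff _ _ (by positivity) (by positivity)
  have s2 : ∀ (l' : ℝ), 0 < l' → ∀ l : ℝ, 0 < l →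
      0 ≤ M * m1 * |l ^ α - l' ^ α| - |fα (l * t₀) - fα (l' * t₀)| := by
    intro l' hl' l hl
    revert l' hl'
    apply rat_dense_nonneg
    · exact (((continuousOn_const.sub hcp).abs).const_mul _).sub
        ((continuousOn_const.sub hcs).abs)
    · intro q' hq'
      exact s1 q' hq' l hl
  have s3 : ∀ (l : ℝ), 0 < l → 0 ≤ M * m1 * l ^ α - |fα (l * t₀) - f 0| := by
    apply rat_dense_nonneg
    · exact (hcp.const_mul _).sub ((hcs.sub continuousOn_const).abs)
    · intro q' hq'
      have := hdiff ((q':ℝ) ^ α) 0 (by positivity) le_rfl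
      rw [hzero, sub_zero, abs_of_nonneg (a := (q':ℝ) ^ α) (by positivity)] at this
      rw [hq q' hq', sub_nonneg]
      exact this
  refine ⟨M * m1 / t₀ ^ α, by positivity, ?_, ?_⟩
  · intro t u ht hu
    have := s2 (u / t₀) (by positivity) (t / t₀) (by positivity)
    rw [div_mul_cancel₀ _ ht₀.ne', div_mul_cancel₀ _ ht₀.ne', Real.div_rpow ht.le ht₀.le,
      Real.div_rpow hu.le ht₀.le, ← sub_div, abs_div,
      abs_of_nonneg (a := t₀ ^ α) (by positivity), sub_nonneg] at this
    refine this.trans (le_of_eq ?_)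
    ring
  · intro t ht
    have := s3 (t / t₀) (by positivity)
    rw [div_mul_cancel₀ _ ht₀.ne', Real.div_rpow ht.le ht₀.le, sub_nonneg] at this
    refine this.trans (le_of_eq ?_)
    ring

theorem deriv_bound (α C : ℝ) (f : ℝ → ℝ) (t d : ℝ) (ht : 0 < t) (hα0 : 0 < α)
    (hd : HasDerivAt f d t)
    (h : ∀ t u, 0 < t → 0 < u → |f t - f u| ≤ C * |t ^ α - u ^ α|) :
    |d| ≤ C * (α * t ^ (α - 1)) := by
  have h1 := (hasDerivAt_iff_tendsto_slope.1 hd).abs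
  have h2 := ((hasDerivAt_iff_tendsto_slope.1
    (Real.hasDerivAt_rpow_const (p := α) (Or.inl ht.ne'))).abs).const_mul C
  rw [abs_of_nonneg (a := α * t ^ (α - 1)) (by positivity)] at h2
  refine le_of_tendsto_of_tendsto h1 h2 ?_
  have : Ioi (0:ℝ) ∈ nhdsWithin t {t}ᶜ := mem_nhdsWithin_of_mem_nhds (Ioi_mem_nhds ht)
  filter_upwards [this] with u hu
  simp only [slope, vsub_eq_sub, smul_eq_mul, abs_mul]
  have := h u t hu ht
  calc |(u - t)⁻¹| * |f u - f t| ≤ |(u - t)⁻¹| * (C * |u ^ α - t ^ α|) := by gcongr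
    _ = _ := by ring

theorem lap_deriv (f : ℝ → ℝ) (f0 s : ℝ) (hd : ∀ t ∈ Ioi (0:ℝ), HasDerivAt f (deriv f t) t)
    (hi : IntegrableOn (fun t => Real.exp (-s * t) * f t) (Ioi 0))
    (hi' : IntegrableOn (fun t => Real.exp (-s * t) * deriv f t) (Ioi 0))
    (h0 : Filter.Tendsto f (nhdsWithin 0 (Ioi 0)) (nhds f0))
    (hinf : Filter.Tendsto (fun t => Real.exp (-s * t) * f t) Filter.atTop (nhds 0)) :
    ∫ t in Ioi (0:ℝ), Real.exp (-s * t) * deriv f t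
      = s * (∫ t in Ioi (0:ℝ), Real.exp (-s * t) * f t) - f0 := by
  have hu : ∀ t ∈ Ioi (0:ℝ), HasDerivAt (fun t => Real.exp (-s * t)) (-s * Real.exp (-s * t)) t := by
    intro t _
    have := ((hasDerivAt_id t).const_mul (-s)).exp
    simp only [id, mul_one] at this
    rwa [mul_comm]
  have h00 : Filter.Tendsto (fun t => Real.exp (-s * t) * f t) (nhdsWithin 0 (Ioi 0)) (nhds f0) := by
    have : Filter.Tendsto (fun t => Real.exp (-s * t)) (nhdsWithin 0 (Ioi 0)) (nhds 1) := by
      have : Continuous (fun t => Real.exp (-s * t)) := by fun_prop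
      simpa using (this.tendsto 0).mono_left nhdsWithin_le_nhds
    simpa using this.mul h0
  have := integral_Ioi_mul_deriv_eq_deriv_mul (u := fun t => Real.exp (-s * t)) (v := f)
    (u' := fun t => -s * Real.exp (-s * t)) hu hd hi'
    (by simpa only [mul_assoc, Pi.mul_def, IntegrableOn] using hi.const_mul (-s)) h00 hinf
  rw [this]
  simp only [mul_assoc, integral_const_mul]
  ring

theorem caputo_avg (α : ℝ) (hα0 : 0 < α) (hα1 : α < 1) (pd : ℝ → ℝ → ℝ)
    (hmeas : Measurable (Function.uncurry pd))
    (hnonneg : ∀ t τ : ℝ, 0 < t → 0 ≤ τ → 0 ≤ pd t τ)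
    (hlap : ∀ s τ : ℝ, 0 < s → 0 ≤ τ →
      IntegrableOn (fun t : ℝ => Real.exp (-s * t) * pd t τ) (Ioi 0) ∧
      ∫ t in Ioi (0 : ℝ), Real.exp (-s * t) * pd t τ = s ^ (α - 1) * Real.exp (-τ * s ^ α))
    (f : ℝ → ℝ) (hf : ContDiff ℝ 1 f) (M : ℝ) (hM : ∀ t, 0 ≤ t → |f t| ≤ M)
    (hM' : ∀ t, 0 ≤ t → |deriv f t| ≤ M)
    (fα : ℝ → ℝ) (hfα : ∀ t, 0 < t → fα t = avgOp pd f t) (hc : ContDiffOn ℝ 1 fα (Ioi 0))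
    (hcap : ContinuousOn (caputoL 0 α fα) (Ioi 0))
    (havg : ContinuousOn (avgOp pd (deriv f)) (Ioi 0)) :
    ∀ t, 0 < t → caputoL 0 α fα t = avgOp pd (deriv f) t := by
  have hfd : Differentiable ℝ f := hf.differentiable one_ne_zero
  have hf'm : Measurable (deriv f) := measurable_deriv f
  have hL : ∀ t u, 0 ≤ t → 0 ≤ u → |f t - f u| ≤ M * |t - u| := by
    intro t u ht hu
    have := Convex.norm_image_sub_le_of_norm_deriv_le (f := f) (s := Ici (0:ℝ)) (C := M)
      (fun x _ => hfd x) (fun x hx => hM' x hx) (convex_Ici 0) hu ht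
    simpa only [Real.norm_eq_abs] using this
  obtain ⟨C, hC0, hC1, hC2⟩ := avg_lip α hα0 pd hmeas hnonneg hlap f hf.continuous.measurable M hM
    hL fα hfα hc.continuousOn
  have hd : ∀ t ∈ Ioi (0:ℝ), HasDerivAt fα (deriv fα t) t := fun t ht =>
    ((hc.differentiableOn one_ne_zero).differentiableAt (Ioi_mem_nhds ht)).hasDerivAt
  have hdb : ∀ t ∈ Ioi (0:ℝ), |deriv fα t| ≤ C * (α * t ^ (α - 1)) := fun t ht =>
    deriv_bound α C fα t _ ht hα0 (hd t ht) hC1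
  have hfe := exp_bdd_integrable f hf.continuous.measurable M hM
  have hf'e := exp_bdd_integrable (deriv f) hf'm M hM'
  have hA := lap_avg α pd hmeas hnonneg hlap f hf.continuous.measurable hfe
  have hA' := lap_avg α pd hmeas hnonneg hlap (deriv f) hf'm hf'e
  have hrpow : ∀ b : ℝ, -1 < b → ∀ s : ℝ, 0 < s →
      IntegrableOn (fun t : ℝ => Real.exp (-s * t) * t ^ b) (Ioi 0) := by
    intro b hb s hs
    have := integrableOn_rpow_mul_exp_neg_mul_rpow (p := 1) (s := b) (b := s) hb one_pos hs
    simpa only [Real.rpow_one, mul_comm] using this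
  have hgam : ∀ s : ℝ, 0 < s → ∫ t in Ioi (0:ℝ), Real.exp (-s * t) * t ^ (-α)
      = s ^ (α - 1) * Real.Gamma (1 - α) := by
    intro s hs
    have := Real.integral_rpow_mul_exp_neg_mul_Ioi (a := 1 - α) (r := s) (by linarith) hs
    rw [one_div, Real.inv_rpow hs.le, ← Real.rpow_neg hs.le, neg_sub] at this
    rw [← this]
    apply setIntegral_congr_fun measurableSet_Ioi
    intro t ht
    simp only
    rw [mul_comm, neg_mul]
    congr 2
    ring
  have hdi : ∀ s : ℝ, 0 < s → IntegrableOn (fun t => Real.exp (-s * t) * deriv fα t) (Ioi 0) := by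
    intro s hs
    refine Integrable.mono' ((hrpow (α - 1) (by linarith) s hs).const_mul (C * α)) ?_ ?_
    · have := measurable_deriv fα
      exact Measurable.aestronglyMeasurable (by fun_prop)
    · refine (ae_restrict_iff' measurableSet_Ioi).2 (.of_forall fun τ hτ => ?_)
      rw [norm_mul, Real.norm_eq_abs, Real.abs_exp]
      calc _ ≤ Real.exp (-s * τ) * (C * (α * τ ^ (α - 1))) := by gcongr; exact hdb τ hτ
        _ = _ := by ring
  have hexp0 : ∀ s : ℝ, 0 < s → Filter.Tendsto (fun t => Real.exp (-s * t)) Filter.atTop (nhds 0) := by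
    intro s hs
    have := tendsto_rpow_mul_exp_neg_mul_atTop_nhds_zero 0 s hs
    simpa using this
  have hfαi : ∀ s : ℝ, 0 < s → IntegrableOn (fun t => Real.exp (-s * t) * fα t) (Ioi 0) :=
    fun s hs => (hA s hs).1.congr_fun (fun t ht => by simp only; rw [hfα t ht]) measurableSet_Ioi
  have hLd : ∀ s : ℝ, 0 < s → ∫ t in Ioi (0:ℝ), Real.exp (-s * t) * deriv fα t
      = s * (∫ t in Ioi (0:ℝ), Real.exp (-s * t) * fα t) - f 0 := by
    intro s hs
    apply lap_deriv fα (f 0) s hd (hfαi s hs) (hdi s hs)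
    · rw [tendsto_iff_norm_sub_tendsto_zero]
      have hz : Filter.Tendsto (fun t : ℝ => C * t ^ α) (nhdsWithin 0 (Ioi 0)) (nhds 0) := by
        have := ((Real.continuousAt_rpow_const 0 α (Or.inr hα0.le)).tendsto.const_mul C).mono_left
          (nhdsWithin_le_nhds (s := Ioi (0:ℝ)))
        simpa [Real.zero_rpow hα0.ne'] using this
      refine squeeze_zero' (.of_forall fun _ => norm_nonneg _) ?_ hz
      filter_upwards [self_mem_nhdsWithin] with t ht using hC2 t ht
    · have h1 := ((tendsto_rpow_mul_exp_neg_mul_atTop_nhds_zero α s hs).const_mul C).add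
        ((hexp0 s hs).mul_const |f 0|)
      simp only [mul_zero, zero_mul, add_zero] at h1
      refine squeeze_zero_norm' ?_ h1
      filter_upwards [Filter.eventually_gt_atTop 0] with t ht
      rw [norm_mul, Real.norm_eq_abs, Real.abs_exp, Real.norm_eq_abs]
      have : |fα t| ≤ C * t ^ α + |f 0| := by
        have h2 := hC2 t ht
        have h3 := abs_sub_abs_le_abs_sub (fα t) (f 0)
        linarith
      calc _ ≤ Real.exp (-s * t) * (C * t ^ α + |f 0|) := by gcongr
        _ = _ := by ring
  have hLf : ∀ s : ℝ, 0 < s → ∫ t in Ioi (0:ℝ), Real.exp (-s * t) * deriv f t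
      = s * (∫ t in Ioi (0:ℝ), Real.exp (-s * t) * f t) - f 0 := by
    intro s hs
    apply lap_deriv f (f 0) s (fun t _ => (hfd t).hasDerivAt) (hfe s hs) (hf'e s hs)
    · exact (hf.continuous.tendsto 0).mono_left nhdsWithin_le_nhds
    · have h1 := (hexp0 s hs).mul_const M
      rw [zero_mul] at h1
      refine squeeze_zero_norm' ?_ h1
      filter_upwards [Filter.eventually_gt_atTop 0] with t ht
      rw [norm_mul, Real.norm_eq_abs, Real.abs_exp]
      gcongr
      exact hM t ht.le
  have hcapeq : ∀ s t : ℝ, Real.exp (-s * t) * caputoL 0 α fα t = (Real.Gamma (1 - α))⁻¹ *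
      ∫ τ in (0:ℝ)..t, (ContinuousLinearMap.mul ℝ ℝ) (Real.exp (-s * τ) * deriv fα τ)
        (Real.exp (-s * (t - τ)) * (t - τ) ^ (-α)) := by
    intro s t
    unfold caputoL
    rw [mul_left_comm, ← intervalIntegral.integral_const_mul]
    congr 2
    funext τ
    rw [ContinuousLinearMap.mul_apply', show -s * t = -s * τ + -s * (t - τ) by ring, Real.exp_add]
    ring
  have hcapi : ∀ s : ℝ, 0 < s →
      IntegrableOn (fun t => Real.exp (-s * t) * caputoL 0 α fα t) (Ioi 0) := by
    intro s hs
    have := integrable_posConvolution (hdi s hs) (hrpow (-α) (by linarith) s hs)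
      (ContinuousLinearMap.mul ℝ ℝ)
    unfold posConvolution at this
    rw [integrable_indicator_iff measurableSet_Ioi] at this
    simp only [hcapeq]
    exact Integrable.const_mul this _
  have hcapL : ∀ s : ℝ, 0 < s → ∫ t in Ioi (0:ℝ), Real.exp (-s * t) * caputoL 0 α fα t
      = s ^ (α - 1) * ∫ t in Ioi (0:ℝ), Real.exp (-s * t) * deriv fα t := by
    intro s hs
    have := integral_posConvolution (hdi s hs) (hrpow (-α) (by linarith) s hs)
      (ContinuousLinearMap.mul ℝ ℝ)
    simp only [hcapeq]
    rw [integral_const_mul, this, hgam s hs, ContinuousLinearMap.mul_apply']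
    have : Real.Gamma (1 - α) ≠ 0 := (Real.Gamma_pos_of_pos (by linarith)).ne'
    field_simp
  have hae : ∀ᵐ t ∂(volume.restrict (Ioi (0:ℝ))), caputoL 0 α fα t - avgOp pd (deriv f) t = 0 := by
    apply lap_uniq
    · intro s hs
      simp only [mul_sub]
      exact (hcapi s hs).sub (hA' s hs).1
    · intro s hs
      have hsa : 0 < s ^ α := by positivity
      simp only [mul_sub]
      rw [integral_sub (hcapi s hs) (hA' s hs).1, hcapL s hs, (hA' s hs).2.1, hLd s hs, hLf _ hsa]
      have e : ∫ t in Ioi (0:ℝ), Real.exp (-s * t) * fα t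
          = ∫ t in Ioi (0:ℝ), Real.exp (-s * t) * avgOp pd f t :=
        setIntegral_congr_fun measurableSet_Ioi fun t ht => by rw [hfα t ht]
      rw [e, (hA s hs).2.1, Real.rpow_sub hs, Real.rpow_one]
      field_simp
      ring
  have := Measure.eqOn_open_of_ae_eq (μ := volume) (U := Ioi (0:ℝ)) (f := caputoL 0 α fα)
    (g := avgOp pd (deriv f)) (by filter_upwards [hae] with t ht; linarith) isOpen_Ioi hcap havg
  exact fun t ht => this ht

/-- compatibility with Stanislavsky's formalism: for a natural Lagrangian
`L(x,v) = ½mv² − U(x)` with Hamiltonian `H(x,p) = p²/(2m) + U(x)`, if the time-averaged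
trajectory `x_α` satisfies the causal fractional Euler–Lagrange equation, then
Stanislavsky's commutation condition for the partial derivatives of `H` holds. -/
theorem compatibility_stanislavsky (α m : ℝ) (hα0 : 0 < α) (hα1 : α < 1) (hm : 0 < m)
    (U : ℝ → ℝ) (hU : ContDiff ℝ 2 U)
    (H : ℝ → ℝ → ℝ) (hH : ∀ x p : ℝ, H x p = p ^ 2 / (2 * m) + U x)
    (x p : ℝ → ℝ) (hx : ContDiff ℝ 1 x) (hp : ContDiff ℝ 1 p)
    (hxeq : ∀ t : ℝ, 0 ≤ t → deriv x t = p t / m)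
    (hpeq : ∀ t : ℝ, 0 ≤ t → deriv p t = -(deriv U (x t)))
    (hbdd : ∃ M : ℝ, ∀ t : ℝ, 0 ≤ t →
      |x t| ≤ M ∧ |p t| ≤ M ∧ |deriv x t| ≤ M ∧ |deriv p t| ≤ M)
    (pd : ℝ → ℝ → ℝ)
    (hmeas : Measurable (Function.uncurry pd))
    (hnonneg : ∀ t τ : ℝ, 0 < t → 0 ≤ τ → 0 ≤ pd t τ)
    (hlap : ∀ s τ : ℝ, 0 < s → 0 ≤ τ →
      IntegrableOn (fun t : ℝ => Real.exp (-s * t) * pd t τ) (Ioi 0) ∧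
      ∫ t in Ioi (0 : ℝ), Real.exp (-s * t) * pd t τ = s ^ (α - 1) * Real.exp (-τ * s ^ α))
    (xα pα : ℝ → ℝ)
    (hint : ∀ t : ℝ, 0 < t →
      IntegrableOn (fun τ : ℝ => pd t τ * x τ) (Ioi 0) ∧
      IntegrableOn (fun τ : ℝ => pd t τ * p τ) (Ioi 0) ∧
      IntegrableOn (fun τ : ℝ => pd t τ * deriv x τ) (Ioi 0) ∧
      IntegrableOn (fun τ : ℝ => pd t τ * deriv p τ) (Ioi 0) ∧
      IntegrableOn (fun τ : ℝ => pd t τ * deriv U (x τ)) (Ioi 0))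
    (hxα : ∀ t : ℝ, 0 < t → xα t = ∫ τ in Ioi (0 : ℝ), pd t τ * x τ)
    (hpα : ∀ t : ℝ, 0 < t → pα t = ∫ τ in Ioi (0 : ℝ), pd t τ * p τ)
    (hxαC : ContDiffOn ℝ 1 xα (Ioi 0)) (hpαC : ContDiffOn ℝ 1 pα (Ioi 0))
    (hreg : ∀ g ∈ ({xα, pα, fun t => caputoL 0 α xα t, fun t => caputoL 0 α pα t,
        fun t => caputoL 0 α (fun s => caputoL 0 α xα s) t,
        fun t => ∫ τ in Ioi (0 : ℝ), pd t τ * deriv x τ,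
        fun t => ∫ τ in Ioi (0 : ℝ), pd t τ * deriv p τ,
        fun t => ∫ τ in Ioi (0 : ℝ), pd t τ * deriv U (x τ)} : Set (ℝ → ℝ)),
      ContinuousOn g (Ioi 0) ∧
      ∃ M c : ℝ, ∀ t : ℝ, 0 < t → |g t| ≤ M * Real.exp (c * t))
    (hEL : ∀ t : ℝ, 0 < t →
      -(deriv U (xα t)) - m * caputoL 0 α (fun s => caputoL 0 α xα s) t = 0) :
    ∀ t : ℝ, 0 < t →
      deriv (fun y => H y (pα t)) (xα t)
        = (∫ τ in Ioi (0 : ℝ), pd t τ * deriv (fun y => H y (p τ)) (x τ)) ∧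
      deriv (fun q => H (xα t) q) (pα t)
        = (∫ τ in Ioi (0 : ℝ), pd t τ * deriv (fun q => H (x τ) q) (p τ)) := by
  obtain ⟨M, hM⟩ := hbdd
  have hx1 := caputo_avg α hα0 hα1 pd hmeas hnonneg hlap x hx M (fun t ht => (hM t ht).1)
    (fun t ht => (hM t ht).2.2.1) xα hxα hxαC
    (hreg (fun t => caputoL 0 α xα t) (by simp)).1
    (hreg (fun t => ∫ τ in Ioi (0 : ℝ), pd t τ * deriv x τ) (by simp)).1
  have hp1 := caputo_avg α hα0 hα1 pd hmeas hnonneg hlap p hp M (fun t ht => (hM t ht).2.1)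
    (fun t ht => (hM t ht).2.2.2) pα hpα hpαC
    (hreg (fun t => caputoL 0 α pα t) (by simp)).1
    (hreg (fun t => ∫ τ in Ioi (0 : ℝ), pd t τ * deriv p τ) (by simp)).1
  have hx2 : ∀ t, 0 < t → caputoL 0 α xα t = m⁻¹ * pα t := by
    intro t ht
    rw [hx1 t ht, hpα t ht, ← integral_const_mul]
    apply setIntegral_congr_fun measurableSet_Ioi
    intro τ hτ
    simp only
    rw [hxeq τ (le_of_lt hτ)]
    ring
  have hp2 : ∀ t, 0 < t → caputoL 0 α pα t = -∫ τ in Ioi (0 : ℝ), pd t τ * deriv U (x τ) := by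
    intro t ht
    rw [hp1 t ht, ← integral_neg]
    apply setIntegral_congr_fun measurableSet_Ioi
    intro τ hτ
    simp only
    rw [hpeq τ (le_of_lt hτ)]
    ring
  have hcc : ∀ t, 0 < t → caputoL 0 α (fun s => caputoL 0 α xα s) t = m⁻¹ * caputoL 0 α pα t := by
    intro t ht
    have hdef : ∀ g : ℝ → ℝ, caputoL 0 α g t
        = (Real.Gamma (1 - α))⁻¹ * ∫ τ in (0:ℝ)..t, (t - τ) ^ (-α) * deriv g τ := fun _ => rfl
    rw [hdef (fun s => caputoL 0 α xα s), hdef pα, mul_left_comm m⁻¹,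
      ← intervalIntegral.integral_const_mul m⁻¹]
    congr 1
    rw [intervalIntegral.integral_of_le ht.le, intervalIntegral.integral_of_le ht.le]
    apply setIntegral_congr_fun measurableSet_Ioc
    intro τ hτ
    have he : (fun s => caputoL 0 α xα s) =ᶠ[nhds τ] fun s => m⁻¹ * pα s := by
      filter_upwards [Ioi_mem_nhds hτ.1] with s hs using hx2 s hs
    have hd := he.deriv_eq
    rw [deriv_const_mul_field] at hd
    change (t - τ) ^ (-α) * deriv (fun s => caputoL 0 α xα s) τ = _
    rw [hd]
    ring
  have hH1 : ∀ y q, deriv (fun y => H y q) y = deriv U y := by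
    intro y q
    simp only [hH]
    rw [deriv_const_add]
  have hH2 : ∀ y q, deriv (fun q => H y q) q = q / m := by
    intro y q
    simp only [hH]
    have : HasDerivAt (fun q : ℝ => q ^ 2 / (2 * m) + U y) (q / m) q := by
      have h1 := (((hasDerivAt_id q).pow 2).div_const (2 * m)).add_const (U y)
      have h2 : q / m = ((2 : ℕ) : ℝ) * id q ^ (2 - 1) * 1 / (2 * m) := by
        simp only [id, Nat.cast_ofNat, Nat.add_one_sub_one, pow_one, mul_one]
        field_simp
      rw [h2]
      exact h1
    exact this.deriv
  intro t ht
  constructor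
  · simp only [hH1]
    have h1 := hEL t ht
    rw [hcc t ht, hp2 t ht] at h1
    field_simp at h1
    linarith
  · simp only [hH2]
    rw [hpα t ht, div_eq_mul_inv, ← integral_mul_const]
    congr 1
    funext τ
    ring
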